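/- arXiv:2401.16113 — 2 statements merged into one kernel-verified Lean document; each statement's English description precedes it below -/
import Mathlib

section
/- (Lemma 3.1.) Let A be an N×N real matrix that is negative semi-definite and diagonalizable over ℂ, τ > 0, α ∈ (0,1), M ≥ 1, and let 𝓜 = B₁ ⊗ I_N − B₂ ⊗ (τA), P_α = C₁^{(α)} ⊗ I_N − C₂^{(α)} ⊗ (τA), J_M = (Q₁⁻¹Q₂)ᴹ. Then P_α is invertible and the characteristic polynomial of P_α⁻¹𝓜 factors as charpoly(P_α⁻¹𝓜) = (X − 1)^{(M−1)N} · charpoly((I − αJ_M)⁻¹); in particular P_α⁻¹𝓜 has (M−1)N eigenvalues equal to 1 and its remaining N eigenvalues are exactly the eigenvalues of (I − αJ_M)⁻¹. -/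
open Matrix Kronecker Polynomial

/-- Euclidean (ℓ²) norm of a real vector. -/
noncomputable def vNorm {n : Type*} [Fintype n] (y : n → ℝ) : ℝ :=
  ‖(EuclideanSpace.equiv n ℝ).symm y‖

/-- Spectral norm (ℓ²-operator norm) of a real matrix. -/
noncomputable def sNorm {n : Type*} [Fintype n] [DecidableEq n] (A : Matrix n n ℝ) : ℝ :=
  ‖Matrix.toEuclideanCLM (𝕜 := ℝ) A‖

/-- `B₁`: M×M lower bidiagonal Toeplitz matrix, 1 on diagonal, −1 on first subdiagonal. -/
noncomputable def B1 (M : ℕ) : Matrix (Fin M) (Fin M) ℝ :=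
  Matrix.of fun i j => if (i : ℕ) = (j : ℕ) then 1 else if (i : ℕ) = (j : ℕ) + 1 then -1 else 0

/-- `B₂`: M×M lower bidiagonal Toeplitz matrix, 1/2 on diagonal and on first subdiagonal. -/
noncomputable def B2 (M : ℕ) : Matrix (Fin M) (Fin M) ℝ :=
  Matrix.of fun i j => if (i : ℕ) = (j : ℕ) then 1/2 else if (i : ℕ) = (j : ℕ) + 1 then 1/2 else 0

/-- `C₁^{(α)}`: B₁ with the additional entry −α in position (1, M). -/
noncomputable def C1 (M : ℕ) (α : ℝ) : Matrix (Fin M) (Fin M) ℝ :=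
  Matrix.of fun i j => B1 M i j + (if (i : ℕ) = 0 ∧ (j : ℕ) = M - 1 then -α else 0)

/-- `C₂^{(α)}`: B₂ with the additional entry α/2 in position (1, M). -/
noncomputable def C2 (M : ℕ) (α : ℝ) : Matrix (Fin M) (Fin M) ℝ :=
  Matrix.of fun i j => B2 M i j + (if (i : ℕ) = 0 ∧ (j : ℕ) = M - 1 then α/2 else 0)

noncomputable def shS (M : ℕ) : Matrix (Fin M) (Fin M) ℝ :=
  Matrix.of fun i j => if (i : ℕ) = (j : ℕ) + 1 then 1 else 0

noncomputable def shE (M : ℕ) : Matrix (Fin M) (Fin M) ℝ :=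
  Matrix.of fun i j => if (i : ℕ) = 0 ∧ (j : ℕ) = M - 1 then 1 else 0

lemma B1_eq (M : ℕ) : B1 M = 1 - shS M := by
  ext i j
  simp only [B1, shS, Matrix.of_apply, Matrix.sub_apply, Matrix.one_apply, Fin.ext_iff]
  split_ifs <;> first | omega | norm_num

lemma B2_eq (M : ℕ) : B2 M = (1/2 : ℝ) • (1 + shS M) := by
  ext i j
  simp only [B2, shS, Matrix.of_apply, Matrix.smul_apply, Matrix.add_apply, Matrix.one_apply,
    Fin.ext_iff]
  split_ifs <;> first | omega | norm_num

lemma C1_eq (M : ℕ) (α : ℝ) : C1 M α = 1 - (shS M + α • shE M) := by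
  ext i j
  simp only [C1, B1_eq, shE, Matrix.of_apply, Matrix.sub_apply, Matrix.add_apply,
    Matrix.smul_apply]
  split_ifs <;> simp <;> ring

lemma C2_eq (M : ℕ) (α : ℝ) : C2 M α = (1/2 : ℝ) • (1 + (shS M + α • shE M)) := by
  ext i j
  simp only [C2, B2_eq, shE, Matrix.of_apply, Matrix.add_apply,
    Matrix.smul_apply]
  split_ifs <;> simp <;> ring

lemma shS_nilp (M : ℕ) : shS M ^ M = 0 := by
  have h : (shS M).charpoly = X ^ M := by
    rw [← Matrix.charpoly_transpose, Matrix.charpoly_of_isUpperTriangular]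
    · simp [shS]
    · intro i j hij
      simp only [shS, Matrix.transpose_apply, Matrix.of_apply]
      have : (j : ℕ) < i := hij
      rw [if_neg (by omega)]
  have := Matrix.aeval_self_charpoly (shS M)
  rw [h] at this
  simpa using this

lemma kron_pow' {m n : Type*} [Fintype m] [DecidableEq m] [Fintype n] [DecidableEq n]
    (S : Matrix m m ℝ) (K : Matrix n n ℝ) (k : ℕ) : (S ⊗ₖ K) ^ k = (S ^ k) ⊗ₖ (K ^ k) := by
  induction k with
  | zero => simp
  | succ k ih => rw [pow_succ, pow_succ, pow_succ, ih, Matrix.mul_kronecker_mul]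

lemma isUnit_of_ker {n : Type*} [Fintype n] [DecidableEq n] (Q : Matrix n n ℝ)
    (h : ∀ y, Q *ᵥ y = 0 → y = 0) : IsUnit Q := by
  rw [← Matrix.mulVec_injective_iff_isUnit]
  intro x y hxy
  have := h (x - y) (by rw [Matrix.mulVec_sub]; exact sub_eq_zero.2 hxy)
  exact sub_eq_zero.1 this

lemma charpoly_one_add {n : Type*} [Fintype n] [DecidableEq n] (Q : Matrix n n ℝ) :
    (1 + Q).charpoly = Q.charpoly.comp (X - 1) := by
  have := Matrix.charpoly_sub_scalar Q (-1)
  simp only [map_neg, map_one, sub_neg_eq_add, ← sub_eq_add_neg] at this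
  rw [← this, add_comm]

lemma charpoly_one_add_mul {M N : ℕ} (hM : 1 ≤ M)
    (u : Matrix (Fin M × Fin N) (Fin N) ℝ) (v : Matrix (Fin N) (Fin M × Fin N) ℝ) :
    (1 + u * v).charpoly = (X - 1) ^ ((M - 1) * N) * (1 + v * u).charpoly := by
  have h := Matrix.charpoly_mul_comm' u v
  have h2 : (u * v).charpoly = X ^ ((M - 1) * N) * (v * u).charpoly := by
    have hX : (X : ℝ[X]) ^ N ≠ 0 := pow_ne_zero _ X_ne_zero
    apply mul_left_cancel₀ hX
    simp only [Fintype.card_prod, Fintype.card_fin] at h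
    rw [h, ← mul_assoc, ← pow_add]
    congr 2
    obtain ⟨m, rfl⟩ := Nat.exists_eq_add_of_le' hM
    simp; ring
  rw [charpoly_one_add, charpoly_one_add, h2]
  simp

lemma key {m N : ℕ} (K G : Matrix (Fin N) (Fin N) ℝ) (α : ℝ)
    (hG : (1 - α • K ^ (m+1)) * G = 1) :
    ∃ (u : Matrix (Fin (m+1) × Fin N) (Fin N) ℝ) (v : Matrix (Fin N) (Fin (m+1) × Fin N) ℝ),
      (1 - (shS (m+1) + α • shE (m+1)) ⊗ₖ K) * (1 + u * v) = 1 - shS (m+1) ⊗ₖ K ∧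
      1 + v * u = G := by
  let u : Matrix (Fin (m+1) × Fin N) (Fin N) ℝ :=
    Matrix.of fun p b => (α • (K ^ ((p.1 : ℕ) + 1) * G)) p.2 b
  let v : Matrix (Fin N) (Fin (m+1) × Fin N) ℝ :=
    Matrix.of fun b p => if p.1 = Fin.last m then (1 : Matrix (Fin N) (Fin N) ℝ) b p.2 else 0
  let w : Matrix (Fin (m+1) × Fin N) (Fin N) ℝ :=
    Matrix.of fun p b => if p.1 = 0 then (α • K) p.2 b else 0
  have hG' : G = 1 + α • (K ^ (m+1) * G) := by
    rw [sub_mul, one_mul, Matrix.smul_mul] at hG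
    rw [← hG]; abel
  have hwv : w * v = (α • shE (m+1)) ⊗ₖ K := by
    ext ⟨i, a⟩ ⟨j, b⟩
    simp only [Matrix.mul_apply, w, v, Matrix.of_apply, Matrix.kronecker_apply, shE,
      Matrix.smul_apply, Fin.ext_iff, Fin.val_last, Fin.val_zero, Nat.add_sub_cancel]
    by_cases hi : (i : ℕ) = 0 <;> by_cases hj : (j : ℕ) = m <;>
      simp [hi, hj, Matrix.one_apply]
  have hmul : ∀ (T : Matrix (Fin (m+1)) (Fin (m+1)) ℝ) i a b, ((T ⊗ₖ K) * u) (i, a) b =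
      ∑ j : Fin (m+1), T i j * (α • (K ^ ((j : ℕ) + 2) * G)) a b := by
    intro T i a b
    rw [Matrix.mul_apply, Fintype.sum_prod_type]
    refine Finset.sum_congr rfl fun j _ => ?_
    rw [pow_succ' K ((j : ℕ) + 1), Matrix.mul_assoc, ← Matrix.mul_smul, Matrix.mul_apply,
      Finset.mul_sum]
    refine Finset.sum_congr rfl fun c _ => ?_
    simp only [Matrix.kronecker_apply, u, Matrix.of_apply, mul_assoc]
  have hu : u - ((shS (m+1) + α • shE (m+1)) ⊗ₖ K) * u = w := by
    ext ⟨i, a⟩ b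
    rw [Matrix.sub_apply, hmul]
    refine Fin.cases ?_ (fun k => ?_) i
    · rw [Finset.sum_eq_single (Fin.last m)]
      · have h1 : K = K * G - α • (K ^ (m+2) * G) := by
          have : K * ((1 - α • K ^ (m+1)) * G) = K := by rw [hG, mul_one]
          rw [sub_mul, one_mul, Matrix.smul_mul, mul_sub, Matrix.mul_smul, ← Matrix.mul_assoc K (K ^ _),
            ← pow_succ'] at this
          exact this.symm
        have h2 : K a b = (K * G) a b - α * (K ^ (m+2) * G) a b := by
          conv_lhs => rw [h1]
          simp
        simp [u, w, shS, shE, h2]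
        ring
      · intro j _ hj
        have : (j : ℕ) ≠ m := fun h => hj (Fin.ext h)
        simp [shS, shE, this]
      · simp
    · rw [Finset.sum_eq_single k.castSucc]
      · simp [u, w, shS, shE]
      · intro j _ hj
        have : (k : ℕ) ≠ j := fun h => hj (Fin.ext h.symm)
        simp [shS, shE, this]
      · simp
  refine ⟨u, v, ?_, ?_⟩
  · have : (1 - (shS (m+1) + α • shE (m+1)) ⊗ₖ K) * (1 + u * v) =
      1 - (shS (m+1) + α • shE (m+1)) ⊗ₖ K +
        (u - ((shS (m+1) + α • shE (m+1)) ⊗ₖ K) * u) * v := by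
      rw [mul_add, mul_one, sub_mul, Matrix.sub_mul, one_mul, Matrix.mul_assoc]
    rw [this, hu, hwv, Matrix.add_kronecker]
    abel
  · have : v * u = α • (K ^ (m+1) * G) := by
      ext a b
      rw [Matrix.mul_apply, Fintype.sum_prod_type, Finset.sum_eq_single (Fin.last m)]
      · simp [v, u, Matrix.one_apply]
      · intro j _ hj
        simp [v, hj]
      · simp
    rw [this, ← hG']

lemma contr {N : ℕ} (B K : Matrix (Fin N) (Fin N) ℝ) (hB : ∀ y, y ⬝ᵥ B *ᵥ y ≤ 0)
    (hQ : IsUnit (1 - B)) (hK : (1 - B) * K = 1 + B) (y : Fin N → ℝ) :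
    (K *ᵥ y) ⬝ᵥ (K *ᵥ y) ≤ y ⬝ᵥ y := by
  have hdet := (Matrix.isUnit_iff_isUnit_det _).1 hQ
  let z := (1 - B)⁻¹ *ᵥ y
  have hy : y = z - B *ᵥ z := by
    have : (1 - B) *ᵥ z = y := by
      simp only [z, Matrix.mulVec_mulVec, Matrix.mul_nonsing_inv _ hdet, Matrix.one_mulVec]
    rw [← this, Matrix.sub_mulVec, Matrix.one_mulVec]
  have hKy : K *ᵥ y = z + B *ᵥ z := by
    apply Matrix.mulVec_injective_iff_isUnit.2 hQ
    rw [Matrix.mulVec_mulVec, hK, hy]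
    simp only [Matrix.add_mulVec, Matrix.sub_mulVec, Matrix.one_mulVec, Matrix.mulVec_sub,
      Matrix.mulVec_add]
    abel
  have h := hB z
  rw [hKy, hy]
  simp only [dotProduct_add, add_dotProduct, dotProduct_sub, sub_dotProduct]
  rw [dotProduct_comm (B *ᵥ z) z]
  linarith

lemma contr_pow {N : ℕ} (K : Matrix (Fin N) (Fin N) ℝ)
    (h : ∀ y, (K *ᵥ y) ⬝ᵥ (K *ᵥ y) ≤ y ⬝ᵥ y) (k : ℕ) (y : Fin N → ℝ) :
    ((K ^ k) *ᵥ y) ⬝ᵥ ((K ^ k) *ᵥ y) ≤ y ⬝ᵥ y := by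
  induction k with
  | zero => simp
  | succ k ih =>
    rw [pow_succ', ← Matrix.mulVec_mulVec]
    exact (h _).trans ih

lemma dot_nonneg {N : ℕ} (y : Fin N → ℝ) : 0 ≤ y ⬝ᵥ y :=
  Finset.sum_nonneg fun i _ => mul_self_nonneg (y i)

/-- Lemma 3.1: P_α is invertible and
charpoly(P_α⁻¹𝓜) = (X − 1)^{(M−1)N} · charpoly((I − αJ_M)⁻¹), where
J_M = (Q₁⁻¹Q₂)ᴹ. -/
theorem stmt_11 {N M : ℕ} (hN : 1 ≤ N) (hM : 1 ≤ M)
    (A : Matrix (Fin N) (Fin N) ℝ) (hA : ∀ y : Fin N → ℝ, y ⬝ᵥ A.mulVec y ≤ 0)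
    (hdiag : ∃ P D : Matrix (Fin N) (Fin N) ℂ, IsUnit P ∧ D.IsDiag ∧
      A.map (algebraMap ℝ ℂ) = P * D * P⁻¹)
    (τ : ℝ) (hτ : 0 < τ) (α : ℝ) (hα0 : 0 < α) (hα1 : α < 1)
    (𝓜 Pα : Matrix (Fin M × Fin N) (Fin M × Fin N) ℝ)
    (h𝓜 : 𝓜 = B1 M ⊗ₖ (1 : Matrix (Fin N) (Fin N) ℝ) - B2 M ⊗ₖ (τ • A))
    (hPα : Pα = C1 M α ⊗ₖ (1 : Matrix (Fin N) (Fin N) ℝ) - C2 M α ⊗ₖ (τ • A))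
    (JM : Matrix (Fin N) (Fin N) ℝ)
    (hJM : JM = ((1 - (τ / 2) • A)⁻¹ * (1 + (τ / 2) • A)) ^ M) :
    IsUnit Pα ∧
    (Pα⁻¹ * 𝓜).charpoly =
      (X - 1) ^ ((M - 1) * N) * ((1 - α • JM)⁻¹).charpoly := by
  set B : Matrix (Fin N) (Fin N) ℝ := (τ / 2) • A with hBdef
  have hB : ∀ y, y ⬝ᵥ B *ᵥ y ≤ 0 := by
    intro y
    rw [hBdef, Matrix.smul_mulVec, dotProduct_smul, smul_eq_mul]
    exact mul_nonpos_of_nonneg_of_nonpos (by positivity) (hA y)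
  have hQ : IsUnit (1 - B) := by
    apply isUnit_of_ker
    intro y hy
    rw [Matrix.sub_mulVec, Matrix.one_mulVec, sub_eq_zero] at hy
    have h1 := hB y
    rw [← hy] at h1
    exact dotProduct_self_eq_zero.1 (le_antisymm h1 (dot_nonneg y))
  have hdet := (Matrix.isUnit_iff_isUnit_det _).1 hQ
  set K := (1 - B)⁻¹ * (1 + B) with hKdef
  have hK : (1 - B) * K = 1 + B := by
    rw [hKdef, ← mul_assoc, Matrix.mul_nonsing_inv _ hdet, one_mul]
  have hcon := contr_pow K (contr B K hB hQ hK) M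
  have hJ : IsUnit (1 - α • JM) := by
    apply isUnit_of_ker
    intro y hy
    rw [Matrix.sub_mulVec, Matrix.one_mulVec, sub_eq_zero, Matrix.smul_mulVec] at hy
    have h1 := hcon y
    rw [← hJM] at h1
    have h2 : y ⬝ᵥ y = α * (α * ((JM *ᵥ y) ⬝ᵥ (JM *ᵥ y))) := by
      conv_lhs => rw [hy]
      rw [smul_dotProduct, dotProduct_smul, smul_eq_mul, smul_eq_mul]
    have h3 := dot_nonneg y
    have h5 : α * α < 1 := by nlinarith
    have h4 : y ⬝ᵥ y ≤ 0 := by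
      have : α * (α * ((JM *ᵥ y) ⬝ᵥ (JM *ᵥ y))) ≤ α * (α * (y ⬝ᵥ y)) := by gcongr
      by_contra! hc
      nlinarith
    exact dotProduct_self_eq_zero.1 (le_antisymm h4 h3)
  have hG : (1 - α • JM) * (1 - α • JM)⁻¹ = 1 :=
    Matrix.mul_nonsing_inv _ ((Matrix.isUnit_iff_isUnit_det _).1 hJ)
  set G := (1 - α • JM)⁻¹
  have fact : ∀ T : Matrix (Fin M) (Fin M) ℝ,
      (1 - T) ⊗ₖ (1 : Matrix (Fin N) (Fin N) ℝ) - ((1/2 : ℝ) • (1 + T)) ⊗ₖ (τ • A) =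
      ((1 : Matrix (Fin M) (Fin M) ℝ) ⊗ₖ (1 - B)) * (1 - T ⊗ₖ K) := by
    intro T
    rw [mul_sub, mul_one, ← Matrix.mul_kronecker_mul, hK, one_mul]
    ext ⟨i, a⟩ ⟨j, b⟩
    simp [hBdef, Matrix.kronecker_apply]
    ring
  have hQ' : IsUnit ((1 : Matrix (Fin M) (Fin M) ℝ) ⊗ₖ (1 - B)) := by
    rw [Matrix.isUnit_iff_isUnit_det, Matrix.det_kronecker]
    simpa using hdet.pow M
  have hMu : IsUnit 𝓜 := by
    rw [h𝓜, B1_eq, B2_eq, fact]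
    refine hQ'.mul (IsNilpotent.isUnit_one_sub ⟨M, ?_⟩)
    rw [kron_pow', shS_nilp, Matrix.zero_kronecker]
  obtain ⟨m, rfl⟩ := Nat.exists_eq_add_of_le' hM
  rw [hJM] at hG
  obtain ⟨u, v, h1, h2⟩ := key K G α hG
  have hPS : Pα * (1 + u * v) = 𝓜 := by
    rw [hPα, h𝓜, B1_eq, B2_eq, C1_eq, C2_eq, fact, fact, mul_assoc, h1]
  have hPu : IsUnit Pα := by
    rw [Matrix.isUnit_iff_isUnit_det] at hMu ⊢
    rw [← hPS, Matrix.det_mul] at hMu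
    exact isUnit_of_mul_isUnit_left hMu
  refine ⟨hPu, ?_⟩
  rw [← hPS, ← mul_assoc, Matrix.nonsing_inv_mul _ ((Matrix.isUnit_iff_isUnit_det _).1 hPu),
    one_mul, charpoly_one_add_mul hM, h2]
end

section
/- Let A be an N×N real symmetric negative semi-definite matrix, τ > 0, M ≥ 1, and let 𝓜 = B₁ ⊗ I_N − B₂ ⊗ (τA), R = E_{1M} ⊗ Q₂, and P_α = 𝓜 − αR. If δ ∈ (0, 1/2) and α = δ/√M, then α‖𝓜⁻¹R‖₂ ≤ δ < 1/2, P_α is invertible, and λ_min(H)² / ‖P_α⁻¹𝓜‖₂² ≥ (1 − 2δ)², where H = ((P_α⁻¹𝓜) + (P_α⁻¹𝓜)ᵀ)/2; consequently 1 − λ_min(H)²/‖P_α⁻¹𝓜‖₂² ≤ 1 − (1 − 2δ)² = 4δ(1 − δ), a bound independent of M, N and τ. -/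
open Matrix Kronecker Polynomial

/-- The M×M matrix with a single 1 in entry (1, M) (0-indexed: (0, M−1)). -/
noncomputable def E1M (M : ℕ) : Matrix (Fin M) (Fin M) ℝ :=
  Matrix.of fun i j => if (i : ℕ) = 0 ∧ (j : ℕ) = M - 1 then 1 else 0


lemma aux_kron {M N : ℕ} (B : Matrix (Fin M) (Fin M) ℝ) (C : Matrix (Fin N) (Fin N) ℝ)
    (y : Fin M × Fin N → ℝ) (i : Fin M) (n : Fin N) :
    ((B ⊗ₖ C) *ᵥ y) (i, n) = ∑ j, B i j * (C *ᵥ fun m => y (j, m)) n := by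
  simp only [Matrix.mulVec, dotProduct, Fintype.sum_prod_type, Matrix.kroneckerMap_apply,
    Finset.mul_sum, mul_assoc]

lemma aux_bidiag {M : ℕ} (a b : ℝ) (f : Fin M → ℝ) (i : Fin M) :
    ∑ j : Fin M, (if (i : ℕ) = (j : ℕ) then a else if (i : ℕ) = (j : ℕ) + 1 then b else 0) * f j
      = a * f i + (if 0 < (i : ℕ) then b * f ⟨i - 1, by omega⟩ else 0) := by
  have h1 : ∀ j : Fin M,
      (if (i : ℕ) = (j : ℕ) then a else if (i : ℕ) = (j : ℕ) + 1 then b else 0) * f j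
      = (if i = j then a * f j else 0) + (if (i : ℕ) = (j : ℕ) + 1 then b * f j else 0) := by
    intro j
    by_cases h : i = j
    · subst h; simp
    · have : (i : ℕ) ≠ (j : ℕ) := fun h' => h (Fin.ext h')
      simp [h, this]
  rw [Finset.sum_congr rfl (fun j _ => h1 j), Finset.sum_add_distrib]
  congr 1
  · simp
  · split_ifs with h0
    · rw [Finset.sum_eq_single (⟨i - 1, by omega⟩ : Fin M)]
      · rw [if_pos]; simp only; omega
      · intro j _ hj
        rw [if_neg]
        intro h'
        apply hj
        apply Fin.ext
        simp only; omega
      · simp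
    · apply Finset.sum_eq_zero
      intro j _
      rw [if_neg]; omega

lemma aux_step {N : ℕ} (A : Matrix (Fin N) (Fin N) ℝ)
    (hA : ∀ y : Fin N → ℝ, y ⬝ᵥ A.mulVec y ≤ 0) (τ : ℝ) (hτ : 0 < τ) (u v : Fin N → ℝ)
    (h : u - (τ / 2) • (A *ᵥ u) = v + (τ / 2) • (A *ᵥ v)) : u ⬝ᵥ u ≤ v ⬝ᵥ v := by
  have h1 : u - v = (τ / 2) • (A *ᵥ (u + v)) := by
    rw [Matrix.mulVec_add, smul_add]
    linear_combination h
  have h2 : (u + v) ⬝ᵥ (u - v) ≤ 0 := by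
    rw [h1, dotProduct_smul, smul_eq_mul]
    have := hA (u + v)
    exact mul_nonpos_of_nonneg_of_nonpos (by positivity) this
  have h3 : (u + v) ⬝ᵥ (u - v) = u ⬝ᵥ u - v ⬝ᵥ v := by
    rw [add_dotProduct, dotProduct_sub, dotProduct_sub, dotProduct_comm v u]; ring
  linarith

lemma aux_main {N M : ℕ} (hM : 1 ≤ M) (A : Matrix (Fin N) (Fin N) ℝ)
    (hA : ∀ y : Fin N → ℝ, y ⬝ᵥ A.mulVec y ≤ 0) (τ : ℝ) (hτ : 0 < τ)
    (x y : Fin M × Fin N → ℝ)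
    (h : (B1 M ⊗ₖ (1 : Matrix (Fin N) (Fin N) ℝ) - B2 M ⊗ₖ (τ • A)) *ᵥ y
      = (E1M M ⊗ₖ (1 + (τ / 2) • A)) *ᵥ x) : y ⬝ᵥ y ≤ M * (x ⬝ᵥ x) := by
  have hrow : ∀ (i : Fin M) (n : Fin N),
      (y (i, n) + (if 0 < (i : ℕ) then -1 * y (⟨i - 1, by omega⟩, n) else 0))
      - (1 / 2 * (τ * (A *ᵥ fun m => y (i, m)) n) + (if 0 < (i : ℕ) then
          1 / 2 * (τ * (A *ᵥ fun m => y (⟨i - 1, by omega⟩, m)) n) else 0))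
      = if (i : ℕ) = 0 then x (⟨M - 1, by omega⟩, n)
          + (τ / 2) * (A *ᵥ fun m => x (⟨M - 1, by omega⟩, m)) n else 0 := by
    intro i n
    have := congrFun h (i, n)
    rw [Matrix.sub_mulVec, Pi.sub_apply, aux_kron, aux_kron, aux_kron] at this
    simp only [B1, B2, E1M, Matrix.of_apply, Matrix.one_mulVec, Matrix.smul_mulVec,
      Pi.smul_apply, smul_eq_mul, Matrix.add_mulVec, Pi.add_apply] at this
    rw [aux_bidiag, aux_bidiag] at this
    rw [Finset.sum_eq_single (⟨M - 1, by omega⟩ : Fin M)] at this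
    · simpa using this
    · intro j _ hj
      rw [if_neg, zero_mul]
      rintro ⟨_, h'⟩
      exact hj (Fin.ext h')
    · simp
  set xl : Fin N → ℝ := fun n => x (⟨M - 1, by omega⟩, n) with hxl
  have hb : ∀ k : ℕ, ∀ hk : k < M,
      (fun n => y (⟨k, hk⟩, n)) ⬝ᵥ (fun n => y (⟨k, hk⟩, n)) ≤ xl ⬝ᵥ xl := by
    intro k
    induction k with
    | zero =>
      intro hk
      apply aux_step A hA τ hτ
      ext n
      have := hrow ⟨0, hk⟩ n
      simp only [lt_irrefl, if_false, if_true] at this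
      simp only [Pi.sub_apply, Pi.add_apply, Pi.smul_apply, smul_eq_mul]
      linear_combination this
    | succ k ih =>
      intro hk
      refine le_trans ?_ (ih (by omega))
      apply aux_step A hA τ hτ
      ext n
      have := hrow ⟨k + 1, hk⟩ n
      simp only [Nat.succ_pos, if_true, Nat.add_sub_cancel, Nat.succ_ne_zero, if_false] at this
      simp only [Pi.sub_apply, Pi.add_apply, Pi.smul_apply, smul_eq_mul]
      linear_combination this
  have hx : xl ⬝ᵥ xl ≤ x ⬝ᵥ x := by
    have : x ⬝ᵥ x = ∑ j : Fin M, (fun n => x (j, n)) ⬝ᵥ (fun n => x (j, n)) := by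
      simp only [dotProduct, Fintype.sum_prod_type]
    rw [this]
    exact Finset.single_le_sum (f := fun j : Fin M => (fun n => x (j, n)) ⬝ᵥ (fun n => x (j, n)))
      (fun j _ => Finset.sum_nonneg fun n _ => mul_self_nonneg _) (Finset.mem_univ _)
  have hy : y ⬝ᵥ y = ∑ j : Fin M, (fun n => y (j, n)) ⬝ᵥ (fun n => y (j, n)) := by
    simp only [dotProduct, Fintype.sum_prod_type]
  rw [hy]
  calc _ ≤ ∑ j : Fin M, x ⬝ᵥ x := Finset.sum_le_sum fun j _ => (hb j j.2).trans hx
    _ = _ := by simp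

lemma aux_unit {n : Type*} [Fintype n] [DecidableEq n] (P : Matrix n n ℝ)
    (h : ∀ y, P *ᵥ y = 0 → y ⬝ᵥ y ≤ 0) : IsUnit P := by
  rw [← Matrix.mulVec_injective_iff_isUnit]
  intro a b hab
  have h1 : P *ᵥ (a - b) = 0 := by rw [Matrix.mulVec_sub]; exact sub_eq_zero.2 hab
  have h2 := h _ h1
  have h3 : (a - b) ⬝ᵥ (a - b) = 0 :=
    le_antisymm h2 (Finset.sum_nonneg fun n _ => mul_self_nonneg _)
  exact sub_eq_zero.1 (dotProduct_self_eq_zero.1 h3)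

lemma aux_norm {n : Type*} [Fintype n] (y : n → ℝ) :
    ‖WithLp.toLp 2 y‖ ^ 2 = y ⬝ᵥ y := by
  rw [EuclideanSpace.norm_sq_eq]
  simp [dotProduct, sq]

lemma aux_sNorm_le {n : Type*} [Fintype n] [DecidableEq n] (T : Matrix n n ℝ) (c : ℝ) (hc : 0 ≤ c)
    (h : ∀ x, ‖WithLp.toLp 2 (T *ᵥ x)‖ ≤ c * ‖WithLp.toLp 2 x‖) : sNorm T ≤ c := by
  apply ContinuousLinearMap.opNorm_le_bound _ hc
  intro x
  exact h (WithLp.ofLp x)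

lemma aux_le_sNorm {n : Type*} [Fintype n] [DecidableEq n] (T : Matrix n n ℝ) (x : n → ℝ) :
    ‖WithLp.toLp 2 (T *ᵥ x)‖ ≤ sNorm T * ‖WithLp.toLp 2 x‖ :=
  ContinuousLinearMap.le_opNorm (Matrix.toEuclideanCLM (𝕜 := ℝ) T) (WithLp.toLp 2 x)

lemma aux_sq {a b : ℝ} (h : a ^ 2 ≤ b ^ 2) (hb : 0 ≤ b) : a ≤ b :=
  abs_le_of_sq_le_sq h hb |> fun h => (le_abs_self a).trans h

/-- for A symmetric negative semi-definite, δ ∈ (0,1/2) and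
α = δ/√M, one has α‖𝓜⁻¹R‖₂ ≤ δ < 1/2, P_α is invertible, and
λ_min(H)²/‖P_α⁻¹𝓜‖₂² ≥ (1−2δ)², hence 1 − λ_min(H)²/‖P_α⁻¹𝓜‖₂² ≤ 4δ(1−δ);
here the eigenvalue bounds are stated for every eigenvalue μ of H. -/
theorem stmt_18 {N M : ℕ} (hN : 1 ≤ N) (hM : 1 ≤ M)
    (A : Matrix (Fin N) (Fin N) ℝ) (hsym : A.IsSymm)
    (hA : ∀ y : Fin N → ℝ, y ⬝ᵥ A.mulVec y ≤ 0)
    (τ : ℝ) (hτ : 0 < τ) (δ : ℝ) (hδ0 : 0 < δ) (hδ1 : δ < 1 / 2)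
    (α : ℝ) (hα : α = δ / Real.sqrt M)
    (𝓜 R Pα H : Matrix (Fin M × Fin N) (Fin M × Fin N) ℝ)
    (h𝓜 : 𝓜 = B1 M ⊗ₖ (1 : Matrix (Fin N) (Fin N) ℝ) - B2 M ⊗ₖ (τ • A))
    (hR : R = E1M M ⊗ₖ (1 + (τ / 2) • A))
    (hPα : Pα = 𝓜 - α • R)
    (hH : H = (1 / 2 : ℝ) • (Pα⁻¹ * 𝓜 + (Pα⁻¹ * 𝓜)ᵀ)) :
    α * sNorm (𝓜⁻¹ * R) ≤ δ ∧
    IsUnit Pα ∧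
    (∀ μ ∈ spectrum ℝ H, (1 - 2 * δ) ^ 2 ≤ μ ^ 2 / (sNorm (Pα⁻¹ * 𝓜)) ^ 2) ∧
    (∀ μ ∈ spectrum ℝ H,
      1 - μ ^ 2 / (sNorm (Pα⁻¹ * 𝓜)) ^ 2 ≤ 4 * δ * (1 - δ)) := by
  have hMpos : (0 : ℝ) < M := by exact_mod_cast hM
  have hsq : 0 < Real.sqrt M := Real.sqrt_pos.2 hMpos
  have hα0 : 0 < α := by rw [hα]; positivity
  have hαM : M * α ^ 2 = δ ^ 2 := by
    rw [hα, div_pow, Real.sq_sqrt hMpos.le]; field_simp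
  have key : ∀ x y, 𝓜 *ᵥ y = R *ᵥ x → y ⬝ᵥ y ≤ M * (x ⬝ᵥ x) := by
    intro x y h
    rw [h𝓜, hR] at h
    exact aux_main hM A hA τ hτ x y h
  have h𝓜u : IsUnit 𝓜 := by
    apply aux_unit
    intro y hy
    have := key 0 y (by simpa using hy)
    simpa using this
  have key2 : ∀ x z, Pα *ᵥ z = 𝓜 *ᵥ x → (z - x) ⬝ᵥ (z - x) ≤ δ ^ 2 * (z ⬝ᵥ z) := by
    intro x z h
    have h1 : 𝓜 *ᵥ (z - x) = R *ᵥ (α • z) := by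
      rw [hPα, Matrix.sub_mulVec, Matrix.smul_mulVec] at h
      rw [Matrix.mulVec_sub, Matrix.mulVec_smul]
      linear_combination h
    have h2 := key _ _ h1
    rw [smul_dotProduct, dotProduct_smul, smul_eq_mul, smul_eq_mul] at h2
    rw [← hαM]
    linarith
  have hPu : IsUnit Pα := by
    apply aux_unit
    intro z hz
    have := key2 0 z (by simpa using hz)
    rw [sub_zero] at this
    by_contra hcon
    push Not at hcon
    have hd2 : δ ^ 2 < 1 := by nlinarith
    have := mul_lt_mul_of_pos_right hd2 hcon
    linarith
  have key3 : ∀ x, ‖WithLp.toLp 2 ((Pα⁻¹ * 𝓜) *ᵥ x - x)‖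
      ≤ δ * ‖WithLp.toLp 2 ((Pα⁻¹ * 𝓜) *ᵥ x)‖ := by
    intro x
    apply aux_sq ?_ (by positivity)
    rw [mul_pow, aux_norm, aux_norm]
    apply key2
    rw [Matrix.mulVec_mulVec, ← mul_assoc,
      Matrix.mul_nonsing_inv _ ((Matrix.isUnit_iff_isUnit_det _).1 hPu), one_mul]
  have key4 : ∀ x, ‖WithLp.toLp 2 ((Pα⁻¹ * 𝓜) *ᵥ x)‖ ≤ 1 / (1 - δ) * ‖WithLp.toLp 2 x‖ := by
    intro x
    have h1 := key3 x
    have h2 : ‖WithLp.toLp 2 ((Pα⁻¹ * 𝓜) *ᵥ x)‖ - ‖WithLp.toLp 2 x‖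
        ≤ ‖WithLp.toLp 2 ((Pα⁻¹ * 𝓜) *ᵥ x - x)‖ := by
      rw [WithLp.toLp_sub]; exact norm_sub_norm_le _ _
    rw [div_mul_eq_mul_div, one_mul, le_div_iff₀ (by linarith)]
    linarith
  have hs : sNorm (Pα⁻¹ * 𝓜) ≤ 1 / (1 - δ) :=
    aux_sNorm_le _ _ (one_div_nonneg.2 (by linarith)) key4
  have hspec : ∀ μ ∈ spectrum ℝ H,
      (1 - 2 * δ) ^ 2 ≤ μ ^ 2 / (sNorm (Pα⁻¹ * 𝓜)) ^ 2 := by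
    intro μ hμ
    obtain ⟨x, hx0, hx⟩ : ∃ x, x ≠ 0 ∧ H *ᵥ x = μ • x := by
      rw [← Matrix.spectrum_toLin', ← Module.End.hasEigenvalue_iff_mem_spectrum] at hμ
      obtain ⟨x, hx⟩ := hμ.exists_hasEigenvector
      exact ⟨x, hx.2, by simpa using hx.apply_eq_smul⟩
    set T := Pα⁻¹ * 𝓜 with hT
    have hxn : 0 < ‖WithLp.toLp 2 x‖ := by
      rw [norm_pos_iff]
      intro h
      exact hx0 (by simpa using h)
    have hTx : μ * (x ⬝ᵥ x) = x ⬝ᵥ (T *ᵥ x) := by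
      have h1 : x ⬝ᵥ (H *ᵥ x) = μ * (x ⬝ᵥ x) := by rw [hx, dotProduct_smul, smul_eq_mul]
      have h2 : x ⬝ᵥ (Tᵀ *ᵥ x) = x ⬝ᵥ (T *ᵥ x) := by
        rw [Matrix.mulVec_transpose, dotProduct_comm, Matrix.dotProduct_mulVec]
      rw [← h1, hH, Matrix.smul_mulVec, dotProduct_smul, Matrix.add_mulVec, dotProduct_add, h2,
        smul_eq_mul]
      ring
    have hcs : -(‖WithLp.toLp 2 x‖ * ‖WithLp.toLp 2 (T *ᵥ x - x)‖) ≤ x ⬝ᵥ (T *ᵥ x - x) := by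
      have h1 := abs_real_inner_le_norm (WithLp.toLp 2 x) (WithLp.toLp 2 (T *ᵥ x - x))
      rw [EuclideanSpace.inner_toLp_toLp, star_trivial, dotProduct_comm] at h1
      exact (abs_le.1 h1).1
    rw [dotProduct_sub, ← hTx, ← aux_norm] at hcs
    have k3 := key3 x
    have k4 := key4 x
    have hs0 : 0 < sNorm T := by
      rcases (norm_nonneg (Matrix.toEuclideanCLM (𝕜 := ℝ) T)).lt_or_eq with h | h
      · exact h
      · exfalso
        have h1 := aux_le_sNorm T x
        have h0 : sNorm T = 0 := h.symm
        rw [h0, zero_mul] at h1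
        have h2 : T *ᵥ x = 0 := by simpa using h1
        rw [h2] at k3
        simp at k3
        exact hx0 k3
    have hd : 0 < 1 - δ := by linarith
    have hμ1 : (1 - 2 * δ) * (1 / (1 - δ)) ≤ μ := by
      set a := ‖WithLp.toLp 2 x‖
      have e : ‖WithLp.toLp 2 (T *ᵥ x - x)‖ ≤ δ * (1 / (1 - δ) * a) :=
        k3.trans (mul_le_mul_of_nonneg_left k4 hδ0.le)
      have e2 := mul_le_mul_of_nonneg_left e hxn.le
      have e3 : (1 - 2 * δ) * (1 / (1 - δ)) = 1 - δ * (1 / (1 - δ)) := by field_simp; ring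
      rw [e3]
      have : (1 - δ * (1 / (1 - δ))) * a ^ 2 ≤ μ * a ^ 2 := by linarith
      exact le_of_mul_le_mul_right this (by positivity)
    rw [← div_pow]
    apply pow_le_pow_left₀ (by linarith)
    rw [le_div_iff₀ hs0]
    exact (mul_le_mul_of_nonneg_left hs (by linarith)).trans hμ1
  refine ⟨?_, hPu, hspec, ?_⟩
  · have : sNorm (𝓜⁻¹ * R) ≤ Real.sqrt M := by
      apply aux_sNorm_le _ _ hsq.le
      intro x
      apply aux_sq ?_ (by positivity)
      rw [mul_pow, aux_norm, aux_norm, Real.sq_sqrt hMpos.le]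
      apply key
      rw [Matrix.mulVec_mulVec, ← mul_assoc,
        Matrix.mul_nonsing_inv _ ((Matrix.isUnit_iff_isUnit_det _).1 h𝓜u), one_mul]
    calc α * sNorm (𝓜⁻¹ * R) ≤ α * Real.sqrt M := mul_le_mul_of_nonneg_left this hα0.le
      _ = δ := by rw [hα]; field_simp
  · intro μ hμ
    have := hspec μ hμ
    nlinarith
end
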